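/- Let d ≥ 2 and let Ω ⊂ ℝ^d be a bounded convex open set. Let (h_l) be a sequence in (0,1) with h_l → 0, and for each l let u_l : Ω_{h_l} → ℝ be a discrete convex grid function, i.e. the central discrete Hessian H̄_d(u_l)(x) is positive semidefinite for every x ∈ Ω_{h_l}⁰. Assume the sequence is locally uniformly bounded: for every compact K ⊂ Ω there is M_K > 0 with |u_l(x)| ≤ M_K for all l and all x ∈ K ∩ Ω_{h_l}. Then there exist a subsequence (l_q) and a convex function v : Ω → ℝ such that for every compact K ⊂ Ω, sup_{x ∈ K ∩ Ω_{h_{l_q}}} |u_{l_q}(x) − v(x)| → 0 as q → ∞. -/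

import Mathlib

noncomputable section

namespace MA

variable {d : ℕ}

/-- the `i`-th standard basis vector of `ℝ^d`. -/
def bv (d : ℕ) (i : Fin d) : Fin d → ℝ := Pi.single i 1

def lamMin (A : Matrix (Fin d) (Fin d) ℝ) : ℝ := sInf (spectrum ℝ A)

def lamMax (A : Matrix (Fin d) (Fin d) ℝ) : ℝ := sSup (spectrum ℝ A)

def symPart (A : Matrix (Fin d) (Fin d) ℝ) : Matrix (Fin d) (Fin d) ℝ :=
  (1 / 2 : ℝ) • (A + A.transpose)

/-- the cofactor matrix: `Aᵀ * cof A = det A • 1`. -/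
def cof (A : Matrix (Fin d) (Fin d) ℝ) : Matrix (Fin d) (Fin d) ℝ :=
  (Matrix.adjugate A).transpose

/-- forward difference quotient `∂₊^i`. -/
def dp (h : ℝ) (i : Fin d) (v : (Fin d → ℝ) → ℝ) (x : Fin d → ℝ) : ℝ :=
  (v (x + h • bv d i) - v x) / h

/-- backward difference quotient `∂₋^i`. -/
def dm (h : ℝ) (i : Fin d) (v : (Fin d → ℝ) → ℝ) (x : Fin d → ℝ) : ℝ :=
  (v x - v (x - h • bv d i)) / h

/-- the discrete Hessian `H_d(v)(x)` with entries `∂₋^j ∂₊^i v(x)`. -/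
def Hd (h : ℝ) (v : (Fin d → ℝ) → ℝ) (x : Fin d → ℝ) : Matrix (Fin d) (Fin d) ℝ :=
  Matrix.of fun i j => dm h j (fun y => dp h i v y) x

/-- the discrete Hessian `Ĥ_d(v)(x)` with entries `∂₋^j ∂₋^i v(x)`. -/
def Hhat (h : ℝ) (v : (Fin d → ℝ) → ℝ) (x : Fin d → ℝ) : Matrix (Fin d) (Fin d) ℝ :=
  Matrix.of fun i j => dm h j (fun y => dm h i v y) x

/-- the central discrete Hessian `H̄_d(v)(x)`. -/
def Hc (h : ℝ) (v : (Fin d → ℝ) → ℝ) (x : Fin d → ℝ) : Matrix (Fin d) (Fin d) ℝ :=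
  Matrix.of fun i j =>
    if i = j then (v (x + h • bv d i) - 2 * v x + v (x - h • bv d i)) / h ^ 2
    else (v (x + h • bv d i + h • bv d j) - v (x + h • bv d i - h • bv d j)
          - v (x - h • bv d i + h • bv d j) + v (x - h • bv d i - h • bv d j)) / (4 * h ^ 2)

/-- the discrete gradient `D_h v = (∂₊^1 v, …, ∂₊^d v)`. -/
def Dh (h : ℝ) (v : (Fin d → ℝ) → ℝ) (x : Fin d → ℝ) : Fin d → ℝ := fun i => dp h i v x

/-- the discrete divergence `div_h w = Σ_i ∂₋^i w_i`. -/
def divh (h : ℝ) (w : (Fin d → ℝ) → Fin d → ℝ) (x : Fin d → ℝ) : ℝ :=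
  ∑ i, dm h i (fun y => w y i) x

/-- the discrete Laplacian `Δ_h v = Σ_i ∂₊^i ∂₋^i v`. -/
def lapH (h : ℝ) (v : (Fin d → ℝ) → ℝ) (x : Fin d → ℝ) : ℝ :=
  ∑ i, dp h i (fun y => dm h i v y) x

/-- the grid `ℤ_h = {x : x_i / h ∈ ℤ}`. -/
def gridZ (d : ℕ) (h : ℝ) : Set (Fin d → ℝ) := {x | ∀ i, ∃ k : ℤ, x i = (k : ℝ) * h}

/-- `Ω_h = cl(Ω) ∩ ℤ_h`. -/
def OmegaH (Ω : Set (Fin d → ℝ)) (h : ℝ) : Set (Fin d → ℝ) := closure Ω ∩ gridZ d h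

/-- `Ω_h⁰ = {x ∈ Ω_h : x ± h e_i ± h e_j ∈ cl(Ω) for all i,j}`. -/
def OmegaH0 (Ω : Set (Fin d → ℝ)) (h : ℝ) : Set (Fin d → ℝ) :=
  {x | x ∈ OmegaH Ω h ∧ ∀ i j : Fin d, ∀ s t : Bool,
    x + (if s then h else -h) • bv d i + (if t then h else -h) • bv d j ∈ closure Ω}

/-- the discrete seminorm `|v|_{1,h}`. -/
def snorm1h (Ω : Set (Fin d → ℝ)) (h : ℝ) (v : (Fin d → ℝ) → ℝ) : ℝ :=
  Real.sqrt (∑ i : Fin d, h ^ d * ∑ᶠ x ∈ OmegaH0 Ω h, (dp h i v x) ^ 2)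

/-- the Hessian matrix `D²v(x)` of second partial derivatives. -/
def hess (v : (Fin d → ℝ) → ℝ) (x : Fin d → ℝ) : Matrix (Fin d) (Fin d) ℝ :=
  Matrix.of fun i j => iteratedFDeriv ℝ 2 v x ![bv d i, bv d j]

/-- the compatible discrete Monge–Ampère operator
`(1/d) div_h [(cof sym H_d v) D_h v]`. -/
def MAh (h : ℝ) (v : (Fin d → ℝ) → ℝ) (x : Fin d → ℝ) : ℝ :=
  (1 / (d : ℝ)) * divh h (fun y => (cof (symPart (Hd h v y))).mulVec (Dh h v y)) x

end MA

namespace MA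

open Filter Topology MeasureTheory

variable {d : ℕ}

theorem exists_symm_second_diff_eq {ψ ψ' ψ'' : ℝ → ℝ} (h1 : ∀ t, HasDerivAt ψ (ψ' t) t)
    (h2 : ∀ t, HasDerivAt ψ' (ψ'' t) t) {h : ℝ} (hh : 0 < h) :
    ∃ θ : ℝ, |θ| ≤ h ∧ ψ h + ψ (-h) - 2 * ψ 0 = h ^ 2 * ψ'' θ := by
  have hG : ∀ t, HasDerivAt (fun t => ψ t + ψ (-t)) (ψ' t - ψ' (-t)) t := by
    intro t
    have := (h1 t).add ((h1 (-t)).comp t (hasDerivAt_neg t))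
    exact this.congr_deriv (by ring)
  have hq : ∀ t : ℝ, HasDerivAt (fun t : ℝ => t ^ 2) (2 * t) t := by
    intro t
    simpa using hasDerivAt_pow 2 t
  obtain ⟨c, hc, hceq⟩ := exists_ratio_hasDerivAt_eq_ratio_slope
    (fun t => ψ t + ψ (-t)) (fun t => ψ' t - ψ' (-t)) hh
    (fun t _ => (hG t).continuousAt.continuousWithinAt) (fun t _ => hG t)
    (fun t : ℝ => t ^ 2) (fun t => 2 * t)
    (fun t _ => (hq t).continuousAt.continuousWithinAt) (fun t _ => hq t)
  obtain ⟨θ, hθ, hθeq⟩ := exists_hasDerivAt_eq_slope ψ' ψ'' (show -c < c by linarith [hc.1])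
    (fun t _ => (h2 t).continuousAt.continuousWithinAt) (fun t _ => h2 t)
  refine ⟨θ, abs_le.2 ⟨by linarith [hθ.1, hc.2], by linarith [hθ.2, hc.2]⟩, ?_⟩
  have hc0 : 0 < c := hc.1
  rw [eq_div_iff (by linarith)] at hθeq
  simp only [neg_zero] at hceq
  have : c * (ψ h + ψ (-h) - 2 * ψ 0) = c * (h ^ 2 * ψ'' θ) := by nlinarith
  exact mul_left_cancel₀ hc0.ne' this

section SecondDifference

variable {E : Type*} [NormedAddCommGroup E] [NormedSpace ℝ E]

theorem hasDerivAt_along_line {F : Type*} [NormedAddCommGroup F] [NormedSpace ℝ F] {f : E → F}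
    (hf : Differentiable ℝ f) (x e : E) (t : ℝ) :
    HasDerivAt (fun t : ℝ => f (x + t • e)) (fderiv ℝ f (x + t • e) e) t := by
  have h1 : HasDerivAt (fun t : ℝ => x + t • e) e t := by
    simpa using ((hasDerivAt_id t).smul_const e).const_add x
  exact (hf _).hasFDerivAt.comp_hasDerivAt t h1

theorem exists_second_diff_eq {φ : E → ℝ} (hφ : ContDiff ℝ 2 φ) (x e : E) {h : ℝ} (hh : 0 < h) :
    ∃ θ : ℝ, |θ| ≤ h ∧ φ (x + h • e) + φ (x - h • e) - 2 * φ x =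
      h ^ 2 * fderiv ℝ (fderiv ℝ φ) (x + θ • e) e e := by
  have h1 : Differentiable ℝ φ := hφ.differentiable (by norm_num)
  have h2 : Differentiable ℝ (fderiv ℝ φ) :=
    (hφ.fderiv_right (m := 1) (by norm_num)).differentiable (by norm_num)
  obtain ⟨θ, hθ, h⟩ := exists_symm_second_diff_eq (hasDerivAt_along_line h1 x e)
    (fun t => (hasDerivAt_along_line h2 x e t).clm_apply (hasDerivAt_const t e)) hh
  refine ⟨θ, hθ, ?_⟩
  simpa [sub_eq_add_neg] using h

theorem continuous_second_fderiv_apply {φ : E → ℝ} (hφ : ContDiff ℝ 2 φ) (e : E) :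
    Continuous fun z => fderiv ℝ (fderiv ℝ φ) z e e := by
  have : Continuous (fderiv ℝ (fderiv ℝ φ)) :=
    (hφ.fderiv_right (m := 1) (by norm_num)).continuous_fderiv (by norm_num)
  fun_prop

theorem tendsto_second_diff {φ : E → ℝ} (hφ : ContDiff ℝ 2 φ) (x e : E) {h : ℕ → ℝ}
    (hh : ∀ l, 0 < h l) (hlim : Tendsto h atTop (𝓝 0)) :
    Tendsto (fun l => (φ (x + h l • e) + φ (x - h l • e) - 2 * φ x) / h l ^ 2) atTop
      (𝓝 (fderiv ℝ (fderiv ℝ φ) x e e)) := by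
  choose θ hθ heq using fun l => exists_second_diff_eq hφ x e (hh l)
  have hθ0 : Tendsto θ atTop (𝓝 0) := squeeze_zero_norm hθ hlim
  have h1 : Tendsto (fun l => x + θ l • e) atTop (𝓝 x) := by
    simpa using (hθ0.smul_const e).const_add x
  have h2 := ((continuous_second_fderiv_apply hφ e).tendsto x).comp h1
  refine h2.congr fun l => ?_
  rw [heq, mul_div_cancel_left₀ _ (pow_ne_zero 2 (hh l).ne')]
  rfl

theorem exists_bound_second_diff {φ : E → ℝ} (hφ : ContDiff ℝ 2 φ) (hc : HasCompactSupport φ)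
    (e : E) :
    ∃ C : ℝ, ∀ x, ∀ h : ℝ, 0 < h →
      |(φ (x + h • e) + φ (x - h • e) - 2 * φ x) / h ^ 2| ≤ C := by
  have hcs : HasCompactSupport fun z => fderiv ℝ (fderiv ℝ φ) z e e :=
    ((hc.fderiv ℝ).fderiv ℝ).comp_left (g := fun B : E →L[ℝ] E →L[ℝ] ℝ => B e e) (by simp)
  obtain ⟨C, hC⟩ := hcs.exists_bound_of_continuous (continuous_second_fderiv_apply hφ e)
  refine ⟨C, fun x h hh => ?_⟩
  obtain ⟨θ, -, heq⟩ := exists_second_diff_eq hφ x e hh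
  rw [heq, mul_div_cancel_left₀ _ (pow_ne_zero 2 hh.ne')]
  exact hC _

end SecondDifference

/-- The entries of the central discrete Hessian in terms of symmetric second differences along
`e_i`, `e_i + e_j` and `e_i - e_j`. -/
theorem Hc_apply_eq (h : ℝ) (v : (Fin d → ℝ) → ℝ) (x : Fin d → ℝ) (i j : Fin d) :
    Hc h v x i j =
      if i = j then (v (x + h • bv d i) + v (x - h • bv d i) - 2 * v x) / h ^ 2
      else ((v (x + h • (bv d i + bv d j)) + v (x - h • (bv d i + bv d j)) - 2 * v x) / h ^ 2
        - (v (x + h • (bv d i - bv d j)) + v (x - h • (bv d i - bv d j)) - 2 * v x) / h ^ 2)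
          / 4 := by
  have e1 : x + h • (bv d i + bv d j) = x + h • bv d i + h • bv d j := by module
  have e2 : x - h • (bv d i + bv d j) = x - h • bv d i - h • bv d j := by module
  have e3 : x + h • (bv d i - bv d j) = x + h • bv d i - h • bv d j := by module
  have e4 : x - h • (bv d i - bv d j) = x - h • bv d i + h • bv d j := by module
  rw [e1, e2, e3, e4, Hc, Matrix.of_apply]
  split_ifs
  · ring
  · ring

theorem tendsto_Hc_apply {φ : (Fin d → ℝ) → ℝ} (hφ : ContDiff ℝ 2 φ) (x : Fin d → ℝ)
    (i j : Fin d) {h : ℕ → ℝ} (hh : ∀ l, 0 < h l) (hlim : Tendsto h atTop (𝓝 0)) :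
    Tendsto (fun l => Hc (h l) φ x i j) atTop
      (𝓝 ((fderiv ℝ (fderiv ℝ φ) x (bv d i) (bv d j)
        + fderiv ℝ (fderiv ℝ φ) x (bv d j) (bv d i)) / 2)) := by
  simp only [Hc_apply_eq]
  split_ifs with hij
  · subst hij
    simpa using tendsto_second_diff hφ x (bv d i) hh hlim
  · have := ((tendsto_second_diff hφ x (bv d i + bv d j) hh hlim).sub
      (tendsto_second_diff hφ x (bv d i - bv d j) hh hlim)).div_const 4
    convert this using 2
    simp only [map_add, map_sub, add_apply, sub_apply]
    ring

theorem exists_bound_Hc_apply {φ : (Fin d → ℝ) → ℝ} (hφ : ContDiff ℝ 2 φ)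
    (hc : HasCompactSupport φ) (i j : Fin d) :
    ∃ C : ℝ, ∀ x, ∀ h : ℝ, 0 < h → |Hc h φ x i j| ≤ C := by
  simp only [Hc_apply_eq]
  split_ifs with hij
  · exact exists_bound_second_diff hφ hc _
  · obtain ⟨C₁, h₁⟩ := exists_bound_second_diff hφ hc (bv d i + bv d j)
    obtain ⟨C₂, h₂⟩ := exists_bound_second_diff hφ hc (bv d i - bv d j)
    refine ⟨C₁ + C₂, fun x h hh => ?_⟩
    have a := abs_le.1 (h₁ x h hh)
    have b := abs_le.1 (h₂ x h hh)
    rw [abs_le]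
    constructor <;> linarith [a.1, a.2, b.1, b.2]

theorem integral_Hc_mul {F φ : (Fin d → ℝ) → ℝ} (hF : Integrable F) (hφ : Continuous φ)
    {C : ℝ} (hC : ∀ x, ‖φ x‖ ≤ C) (h : ℝ) (i j : Fin d) :
    Integrable (fun y => Hc h F y i j * φ y) ∧
      ∫ y, Hc h F y i j * φ y = ∫ y, F y * Hc h φ y i j := by
  have hI : ∀ a : Fin d → ℝ, Integrable fun y => F (y + a) * φ y := fun a =>
    (hF.comp_add_right a).mul_bdd (c := C) hφ.aestronglyMeasurable (Eventually.of_forall hC)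
  have hJ : ∀ a : Fin d → ℝ, Integrable fun y => F y * φ (y + a) := fun a =>
    hF.mul_bdd (c := C) (hφ.comp (continuous_add_const a)).aestronglyMeasurable
      (Eventually.of_forall fun y => hC _)
  have hS : ∀ a : Fin d → ℝ, ∫ y, F (y + a) * φ y = ∫ y, F y * φ (y + -a) := fun a => by
    rw [← integral_add_right_eq_self (fun y => F y * φ (y + -a)) a]
    simp
  have hI0 : Integrable fun y => F y * φ y := by simpa using hI 0
  have key : ∀ e : Fin d → ℝ,
      Integrable (fun y => (F (y + h • e) + F (y - h • e) - 2 * F y) / h ^ 2 * φ y) ∧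
      Integrable (fun y => F y * ((φ (y + h • e) + φ (y - h • e) - 2 * φ y) / h ^ 2)) ∧
      ∫ y, (F (y + h • e) + F (y - h • e) - 2 * F y) / h ^ 2 * φ y =
        ∫ y, F y * ((φ (y + h • e) + φ (y - h • e) - 2 * φ y) / h ^ 2) := by
    intro e
    have a1 : (fun y => (F (y + h • e) + F (y - h • e) - 2 * F y) / h ^ 2 * φ y) = fun y =>
        (F (y + h • e) * φ y + F (y + -(h • e)) * φ y - 2 * (F y * φ y)) / h ^ 2 := by
      funext y; rw [sub_eq_add_neg y]; ring
    have a2 : (fun y => F y * ((φ (y + h • e) + φ (y - h • e) - 2 * φ y) / h ^ 2)) = fun y =>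
        (F y * φ (y + h • e) + F y * φ (y + -(h • e)) - 2 * (F y * φ y)) / h ^ 2 := by
      funext y; rw [sub_eq_add_neg y]; ring
    rw [a1, a2]
    refine ⟨(((hI _).add (hI _)).sub (hI0.const_mul 2)).div_const _,
      (((hJ _).add (hJ _)).sub (hI0.const_mul 2)).div_const _, ?_⟩
    rw [integral_div, integral_div, integral_sub (by exact (hI _).add (hI _)) (hI0.const_mul 2),
      integral_sub (by exact (hJ _).add (hJ _)) (hI0.const_mul 2), integral_add (hI _) (hI _),
      integral_add (hJ _) (hJ _), hS, hS, neg_neg]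
    ring
  simp only [Hc_apply_eq]
  split_ifs with hij
  · exact ⟨(key _).1, (key _).2.2⟩
  · obtain ⟨p1, p2, p3⟩ := key (bv d i + bv d j)
    obtain ⟨q1, q2, q3⟩ := key (bv d i - bv d j)
    have b1 : ∀ a b c : ℝ, (a - b) / 4 * c = (a * c - b * c) / 4 := fun a b c => by ring
    have b2 : ∀ a b c : ℝ, c * ((a - b) / 4) = (c * a - c * b) / 4 := fun a b c => by ring
    simp only [b1, b2]
    refine ⟨(p1.sub q1).div_const 4, ?_⟩
    rw [integral_div, integral_div, integral_sub p1 q1, integral_sub p2 q2, p3, q3]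

theorem sum_smul_bv (ξ : Fin d → ℝ) : ∑ i, ξ i • bv d i = ξ := by
  simpa [bv, ← Pi.single_smul] using Finset.univ_sum_single ξ

theorem sum_symm_bilin (B : (Fin d → ℝ) →L[ℝ] (Fin d → ℝ) →L[ℝ] ℝ) (ξ : Fin d → ℝ) :
    ∑ i, ∑ j, ξ i * ξ j * ((B (bv d i) (bv d j) + B (bv d j) (bv d i)) / 2) = B ξ ξ := by
  have h1 : B ξ ξ = ∑ i, ∑ j, ξ i * ξ j * B (bv d i) (bv d j) := by
    conv_lhs => rw [← sum_smul_bv ξ]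
    simp only [map_sum, map_smul, sum_apply, smul_apply, smul_eq_mul,
      Finset.mul_sum, mul_assoc]
    rw [Finset.sum_comm]
    exact Finset.sum_congr rfl fun i _ => Finset.sum_congr rfl fun j _ => mul_left_comm _ _ _
  have h2 : B ξ ξ = ∑ i, ∑ j, ξ i * ξ j * B (bv d j) (bv d i) := by
    rw [h1, Finset.sum_comm]
    simp only [mul_comm (ξ _) (ξ _)]
  have h3 : ∑ i, ∑ j, ξ i * ξ j * ((B (bv d i) (bv d j) + B (bv d j) (bv d i)) / 2) =
      (∑ i, ∑ j, ξ i * ξ j * B (bv d i) (bv d j) + ∑ i, ∑ j, ξ i * ξ j * B (bv d j) (bv d i))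
        / 2 := by
    simp only [← Finset.sum_add_distrib, Finset.sum_div]
    exact Finset.sum_congr rfl fun i _ => Finset.sum_congr rfl fun j _ => by ring
  rw [h3, ← h1, ← h2]
  ring

theorem integral_mul_second_fderiv_nonneg {K : Set (Fin d → ℝ)} (hK : IsCompact K)
    {F : ℕ → (Fin d → ℝ) → ℝ} {G φ : (Fin d → ℝ) → ℝ} {h : ℕ → ℝ} {M : ℝ} (hh : ∀ l, 0 < h l)
    (hlim : Tendsto h atTop (𝓝 0)) (hFm : ∀ l, Measurable (F l))
    (hFb : ∀ᶠ l in atTop, ∀ y, |F l y| ≤ M) (hF0 : ∀ l, ∀ y ∉ K, F l y = 0)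
    (hFG : ∀ y, Tendsto (fun l => F l y) atTop (𝓝 (G y)))
    (hφ : ContDiff ℝ 2 φ) (hc : HasCompactSupport φ) (hφ0 : ∀ y, 0 ≤ φ y) (ξ : Fin d → ℝ)
    (hL : ∀ᶠ l in atTop, ∀ y, φ y ≠ 0 → 0 ≤ ∑ i, ∑ j, ξ i * ξ j * Hc (h l) (F l) y i j) :
    0 ≤ ∫ y, G y * fderiv ℝ (fderiv ℝ φ) y ξ ξ := by
  obtain ⟨Cφ, hCφ⟩ := hc.exists_bound_of_continuous hφ.continuous
  have hbI : Integrable (K.indicator fun _ => M) :=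
    (integrable_indicator_iff hK.measurableSet).2 (integrableOn_const hK.measure_lt_top.ne)
  have hFb' : ∀ᶠ l in atTop, ∀ y, ‖F l y‖ ≤ K.indicator (fun _ => M) y := by
    filter_upwards [hFb] with l hl y
    by_cases hy : y ∈ K
    · simpa [hy] using hl y
    · simp [hy, hF0 l y hy]
  have hFI : ∀ᶠ l in atTop, Integrable (F l) := by
    filter_upwards [hFb'] with l hl
    exact hbI.mono' (hFm l).aestronglyMeasurable (Eventually.of_forall hl)
  choose C hC using fun i j => exists_bound_Hc_apply hφ hc i j
  have hcont : ∀ (l : ℕ) (i j : Fin d), Continuous fun y => Hc (h l) φ y i j := by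
    intro l i j
    have := hφ.continuous
    simp only [Hc_apply_eq]
    split_ifs <;> fun_prop
  have hlimI : Tendsto (fun l => ∫ y, F l y * ∑ i, ∑ j, ξ i * ξ j * Hc (h l) φ y i j) atTop
      (𝓝 (∫ y, G y * fderiv ℝ (fderiv ℝ φ) y ξ ξ)) := by
    refine tendsto_integral_filter_of_dominated_convergence
      (fun y => K.indicator (fun _ => M) y * ∑ i, ∑ j, |ξ i * ξ j| * C i j) ?_ ?_
      (hbI.mul_const _) ?_
    · refine Eventually.of_forall fun l => ((hFm l).mul ?_).aestronglyMeasurable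
      exact Continuous.measurable (continuous_finsetSum _ fun i _ =>
        continuous_finsetSum _ fun j _ => (hcont l i j).const_mul _)
    · filter_upwards [hFb'] with l hl
      refine Eventually.of_forall fun y => ?_
      rw [norm_mul]
      refine mul_le_mul (hl y) ?_ (norm_nonneg _) ((norm_nonneg _).trans (hl y))
      refine (norm_sum_le _ _).trans (Finset.sum_le_sum fun i _ =>
        (norm_sum_le _ _).trans (Finset.sum_le_sum fun j _ => ?_))
      rw [norm_mul]
      exact mul_le_mul_of_nonneg_left (hC i j y _ (hh l)) (norm_nonneg _)
    · refine Eventually.of_forall fun y => (hFG y).mul ?_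
      rw [← sum_symm_bilin]
      exact tendsto_finsetSum _ fun i _ => tendsto_finsetSum _ fun j _ =>
        (tendsto_Hc_apply hφ y i j hh hlim).const_mul _
  refine ge_of_tendsto hlimI ?_
  filter_upwards [hFI, hL] with l hl hLl
  have hparts := fun i j => integral_Hc_mul hl hφ.continuous hCφ (h l) i j
  have hI2 : ∀ i j, Integrable fun y => F l y * Hc (h l) φ y i j := fun i j =>
    hl.mul_bdd (c := C i j) (hcont l i j).aestronglyMeasurable
      (Eventually.of_forall fun y => hC i j y _ (hh l))
  have e1 : ∫ y, F l y * ∑ i, ∑ j, ξ i * ξ j * Hc (h l) φ y i j =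
      ∑ i, ∑ j, ξ i * ξ j * ∫ y, F l y * Hc (h l) φ y i j := by
    simp only [Finset.mul_sum, mul_left_comm (F l _)]
    rw [integral_finsetSum _ fun i _ => integrable_finsetSum _ fun j _ =>
      (hI2 i j).const_mul _]
    refine Finset.sum_congr rfl fun i _ => ?_
    rw [integral_finsetSum _ fun j _ => (hI2 i j).const_mul _]
    exact Finset.sum_congr rfl fun j _ => integral_const_mul _ _
  have e2 : ∫ y, (∑ i, ∑ j, ξ i * ξ j * Hc (h l) (F l) y i j) * φ y =
      ∑ i, ∑ j, ξ i * ξ j * ∫ y, Hc (h l) (F l) y i j * φ y := by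
    simp only [Finset.sum_mul, mul_assoc (_ * _)]
    rw [integral_finsetSum _ fun i _ => integrable_finsetSum _ fun j _ =>
      (hparts i j).1.const_mul _]
    refine Finset.sum_congr rfl fun i _ => ?_
    rw [integral_finsetSum _ fun j _ => (hparts i j).1.const_mul _]
    exact Finset.sum_congr rfl fun j _ => integral_const_mul _ _
  rw [e1]
  simp only [← (hparts _ _).2]
  rw [← e2]
  refine integral_nonneg fun y => ?_
  by_cases hy : φ y = 0
  · simp [hy]
  · exact mul_nonneg (hLl y hy) (hφ0 y)

theorem second_fderiv_comp_const_sub {E : Type*} [NormedAddCommGroup E] [NormedSpace ℝ E]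
    {ρ : E → ℝ} (hρ : ContDiff ℝ 2 ρ) (x y ξ : E) :
    fderiv ℝ (fderiv ℝ fun y => ρ (x - y)) y ξ ξ = fderiv ℝ (fderiv ℝ ρ) (x - y) ξ ξ := by
  have h1 : (fderiv ℝ fun y => ρ (x - y)) = fun y => -fderiv ℝ ρ (x - y) := by
    funext z
    have := (hρ.differentiable (by norm_num) (x - z)).hasFDerivAt.comp z
      ((hasFDerivAt_id z).const_sub x)
    refine this.fderiv.trans ?_
    ext
    simp
  have hd : Differentiable ℝ (fderiv ℝ ρ) :=
    (hρ.fderiv_right (m := 1) (by norm_num)).differentiable (by norm_num)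
  have h2 : HasFDerivAt (fun y => -fderiv ℝ ρ (x - y)) _ y :=
    ((hd (x - y)).hasFDerivAt.comp y ((hasFDerivAt_id y).const_sub x)).neg
  rw [h1, h2.fderiv]
  simp

section Mollification

variable {E : Type*} [NormedAddCommGroup E] [NormedSpace ℝ E] [MeasurableSpace E] [BorelSpace E]
  {μ : Measure E}

theorem hasDerivAt_integral_comp_sub_mul {F ρ : E → ℝ} (hF : Integrable F μ)
    (hρ : ContDiff ℝ 1 ρ) (hc : HasCompactSupport ρ) (x ξ : E) (t : ℝ) :
    HasDerivAt (fun t : ℝ => ∫ y, F y * ρ (x + t • ξ - y) ∂μ)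
      (∫ y, F y * fderiv ℝ ρ (x + t • ξ - y) ξ ∂μ) t := by
  have hcont : Continuous fun z => fderiv ℝ ρ z ξ := by
    have := hρ.continuous_fderiv (by norm_num)
    fun_prop
  obtain ⟨C, hC⟩ := HasCompactSupport.exists_bound_of_continuous
    ((hc.fderiv ℝ).comp_left (g := fun A : E →L[ℝ] ℝ => A ξ) (by simp)) hcont
  obtain ⟨C₀, hC₀⟩ := hc.exists_bound_of_continuous hρ.continuous
  have hm : ∀ (s : ℝ) (g : E → ℝ), Continuous g →
      AEStronglyMeasurable (fun y => g (x + s • ξ - y)) μ := fun s g hg =>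
    (hg.comp (by fun_prop)).aestronglyMeasurable
  refine (hasDerivAt_integral_of_dominated_loc_of_deriv_le (s := Set.univ)
    (F' := fun s y => F y * fderiv ℝ ρ (x + s • ξ - y) ξ)
    (bound := fun y => ‖F y‖ * C) univ_mem
    (Eventually.of_forall fun s => hF.aestronglyMeasurable.mul (hm s ρ hρ.continuous))
    (hF.mul_bdd (c := C₀) (hm t ρ hρ.continuous) (Eventually.of_forall fun y => hC₀ _))
    (hF.aestronglyMeasurable.mul (hm t _ hcont)) ?_ (hF.norm.mul_const C) ?_).2
  · refine Eventually.of_forall fun y s _ => ?_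
    rw [norm_mul]
    exact mul_le_mul_of_nonneg_left (hC _) (norm_nonneg _)
  · refine Eventually.of_forall fun y s _ => HasDerivAt.const_mul _ ?_
    have := hasDerivAt_along_line (hρ.differentiable (by norm_num)) (x - y) ξ s
    simpa only [sub_add_eq_add_sub] using this

theorem convexOn_integral_comp_sub_mul {F ρ : E → ℝ} (hF : Integrable F μ)
    (hρ : ContDiff ℝ 2 ρ) (hc : HasCompactSupport ρ) (x ξ : E) {D : Set ℝ} (hD : Convex ℝ D)
    (h0 : ∀ t ∈ D, 0 ≤ ∫ y, F y * fderiv ℝ (fderiv ℝ ρ) (x + t • ξ - y) ξ ξ ∂μ) :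
    ConvexOn ℝ D fun t : ℝ => ∫ y, F y * ρ (x + t • ξ - y) ∂μ := by
  have hρ' : ContDiff ℝ 1 (fderiv ℝ ρ) := hρ.fderiv_right (m := 1) (by norm_num)
  have h1 := hasDerivAt_integral_comp_sub_mul hF (hρ.of_le (by norm_num)) hc x ξ
  have h2 := hasDerivAt_integral_comp_sub_mul (ρ := fun z => fderiv ℝ ρ z ξ) hF
    (hρ'.clm_apply contDiff_const)
    ((hc.fderiv ℝ).comp_left (g := fun A : E →L[ℝ] ℝ => A ξ) (by simp)) x ξ
  have hfd : ∀ z, fderiv ℝ (fun z => fderiv ℝ ρ z ξ) z ξ = fderiv ℝ (fderiv ℝ ρ) z ξ ξ := by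
    intro z
    rw [fderiv_clm_apply (hρ'.differentiable (by norm_num) z) (differentiableAt_const ξ)]
    simp
  simp only [hfd] at h2
  have hd1 : deriv (fun t : ℝ => ∫ y, F y * ρ (x + t • ξ - y) ∂μ) =
      fun t => ∫ y, F y * fderiv ℝ ρ (x + t • ξ - y) ξ ∂μ := funext fun t => (h1 t).deriv
  refine convexOn_of_deriv2_nonneg' hD
    (fun t _ => (h1 t).differentiableAt.differentiableWithinAt) ?_ ?_
  · rw [hd1]
    exact fun t _ => (h2 t).differentiableAt.differentiableWithinAt
  · intro t ht
    rw [Function.iterate_succ, Function.iterate_one, Function.comp_apply, hd1, (h2 t).deriv]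
    exact h0 t ht

end Mollification

theorem norm_real_smul_bv (c : ℝ) (i : Fin d) : ‖c • bv d i‖ = |c| := by
  rw [norm_smul, bv, Pi.norm_single]
  simp

theorem Hc_congr {h : ℝ} (hh : 0 ≤ h) {v w : (Fin d → ℝ) → ℝ} {x : Fin d → ℝ}
    (hvw : ∀ y ∈ Metric.closedBall x (2 * h), v y = w y) : Hc h v x = Hc h w x := by
  have hn := fun i : Fin d => (norm_real_smul_bv h i).trans_le (abs_of_nonneg hh).le
  have h0 : v x = w x := hvw x (Metric.mem_closedBall_self (by linarith))
  have h1 : ∀ i, v (x + h • bv d i) = w (x + h • bv d i) := fun i =>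
    hvw _ (by simpa [mem_closedBall_iff_norm] using (hn i).trans (by linarith))
  have h2 : ∀ i, v (x - h • bv d i) = w (x - h • bv d i) := fun i =>
    hvw _ (by simpa [mem_closedBall_iff_norm] using (hn i).trans (by linarith))
  have key : ∀ e : Fin d → ℝ, ‖e‖ ≤ 2 * h → v (x + e) = w (x + e) := fun e he =>
    hvw _ (by simpa [mem_closedBall_iff_norm] using he)
  have h3 : ∀ i j, v (x + h • bv d i + h • bv d j) = w (x + h • bv d i + h • bv d j) :=
    fun i j => by
      rw [add_assoc]
      exact key _ ((norm_add_le _ _).trans (by linarith [hn i, hn j]))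
  have h4 : ∀ i j, v (x + h • bv d i - h • bv d j) = w (x + h • bv d i - h • bv d j) :=
    fun i j => by
      rw [add_sub_assoc]
      exact key _ ((norm_sub_le _ _).trans (by linarith [hn i, hn j]))
  have h5 : ∀ i j, v (x - h • bv d i + h • bv d j) = w (x - h • bv d i + h • bv d j) :=
    fun i j => by
      rw [sub_add, sub_eq_add_neg]
      exact key _ ((norm_neg _).le.trans ((norm_sub_le _ _).trans (by linarith [hn i, hn j])))
  have h6 : ∀ i j, v (x - h • bv d i - h • bv d j) = w (x - h • bv d i - h • bv d j) :=
    fun i j => by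
      rw [sub_sub, sub_eq_add_neg]
      exact key _ ((norm_neg _).le.trans ((norm_add_le _ _).trans (by linarith [hn i, hn j])))
  ext i j
  simp only [Hc, Matrix.of_apply, h0, h1, h2, h3, h4, h5, h6]

theorem convexOn_of_tendsto_of_Hc_nonneg {Ω : Set (Fin d → ℝ)} (hΩo : IsOpen Ω)
    (hΩc : Convex ℝ Ω) {f : ℕ → (Fin d → ℝ) → ℝ} {v : (Fin d → ℝ) → ℝ} {h : ℕ → ℝ}
    (hh : ∀ l, 0 < h l) (hlim : Tendsto h atTop (𝓝 0)) (hfm : ∀ l, Measurable (f l))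
    (hfv : ∀ y ∈ Ω, Tendsto (fun l => f l y) atTop (𝓝 (v y))) (hv : ContinuousOn v Ω)
    (hfb : ∀ K, IsCompact K → K ⊆ Ω → ∃ M : ℝ, ∀ᶠ l in atTop, ∀ y ∈ K, |f l y| ≤ M)
    (hL : ∀ K, IsCompact K → K ⊆ Ω → ∀ᶠ l in atTop, ∀ y ∈ K, ∀ ξ : Fin d → ℝ,
      0 ≤ ∑ i, ∑ j, ξ i * ξ j * Hc (h l) (f l) y i j) :
    ConvexOn ℝ Ω v := by
  refine ⟨hΩc, fun x hx y hy a b ha hb hab => ?_⟩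
  have hSc : IsCompact (segment ℝ x y) := by
    rw [segment_eq_image_lineMap]
    exact isCompact_Icc.image AffineMap.lineMap_continuous
  have hSΩ : segment ℝ x y ⊆ Ω := hΩc.segment_subset hx hy
  obtain ⟨δ, hδ, hKΩ⟩ := hSc.exists_cthickening_subset_open hΩo hSΩ
  set K := Metric.cthickening δ (segment ℝ x y) with hKdef
  have hK : IsCompact K := hSc.cthickening
  have hball : ∀ z ∈ segment ℝ x y, Metric.closedBall z δ ⊆ K := fun z hz =>
    Metric.closedBall_subset_cthickening hz δ
  obtain ⟨M, hM⟩ := hfb K hK hKΩ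
  have hM0 : 0 ≤ M := by
    obtain ⟨l, hl⟩ := hM.exists
    exact (abs_nonneg _).trans
      (hl x (hball x (left_mem_segment ℝ x y) (Metric.mem_closedBall_self hδ.le)))
  have hFm : ∀ l, Measurable (K.indicator (f l)) := fun l => (hfm l).indicator hK.measurableSet
  have hFb : ∀ᶠ l in atTop, ∀ y, |K.indicator (f l) y| ≤ M := by
    filter_upwards [hM] with l hl y
    by_cases hy : y ∈ K
    · simpa [hy] using hl y hy
    · simpa [hy] using hM0
  have hFG : ∀ y, Tendsto (fun l => K.indicator (f l) y) atTop (𝓝 (K.indicator v y)) := by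
    intro y
    by_cases hy : y ∈ K
    · simpa [hy] using hfv y (hKΩ hy)
    · simp [hy]
  have hGm : Measurable (K.indicator v) :=
    measurable_of_tendsto_metrizable hFm (tendsto_pi_nhds.2 hFG)
  have hGI : Integrable (K.indicator v) := by
    refine Integrable.mono' (g := K.indicator fun _ => M)
      ((integrable_indicator_iff hK.measurableSet).2 (integrableOn_const hK.measure_lt_top.ne))
      hGm.aestronglyMeasurable (Eventually.of_forall fun y => ?_)
    by_cases hy : y ∈ K
    · simpa [hy] using le_of_tendsto (hFG y).abs (hFb.mono fun l hl => hl y)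
    · simp [hy]
  let ρ : ℕ → ContDiffBump (0 : Fin d → ℝ) := fun n =>
    ⟨δ / 4 / (n + 1), δ / 2 / (n + 1), by positivity, by gcongr; norm_num⟩
  have hρ0 : Tendsto (fun n => (ρ n).rOut) atTop (𝓝 0) :=
    tendsto_const_div_atTop_nhds_zero_nat (δ / 2) |>.comp (tendsto_add_atTop_nat 1) |>.congr
      fun n => by simp [ρ]
  have hρle : ∀ n, (ρ n).rOut ≤ δ / 2 := fun n =>
    div_le_self (by positivity) (by simp)
  have hconvex : ∀ n, ConvexOn ℝ (Set.Icc (0 : ℝ) 1) fun t : ℝ =>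
      ∫ w, K.indicator v w * (ρ n).normed volume (x + t • (y - x) - w) := by
    intro n
    have hρn : ContDiff ℝ 2 ((ρ n).normed volume) := (ρ n).contDiff_normed
    refine convexOn_integral_comp_sub_mul hGI hρn (ρ n).hasCompactSupport_normed x (y - x)
      (convex_Icc 0 1) fun t ht => ?_
    have hz : x + t • (y - x) ∈ segment ℝ x y := by
      rw [segment_eq_image']
      exact ⟨t, ht, rfl⟩
    set z := x + t • (y - x)
    simp only [← second_fderiv_comp_const_sub hρn]
    refine integral_mul_second_fderiv_nonneg hK hh hlim hFm hFb
      (fun l w hw => by simp [hw]) hFG (hρn.comp (by fun_prop)) ?_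
      (fun w => (ρ n).nonneg_normed _) _ ?_
    · exact (ρ n).hasCompactSupport_normed.comp_homeomorph (Homeomorph.subLeft z)
    · filter_upwards [hL K hK hKΩ, hlim.eventually (eventually_le_nhds (show (0 : ℝ) < δ / 4 by linarith))]
        with l hl hhl w hw
      have hw' : dist w z < δ / 2 := by
        have : z - w ∈ Function.support ((ρ n).normed volume) := hw
        rw [ContDiffBump.support_normed_eq, mem_ball_zero_iff] at this
        rw [dist_comm, dist_eq_norm]
        exact this.trans_le (hρle n)
      have hsub : Metric.closedBall w (2 * h l) ⊆ K := fun p hp => hball z hz <| by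
        rw [Metric.mem_closedBall] at hp ⊢
        linarith [dist_triangle p w z]
      rw [Hc_congr (hh l).le (w := f l) fun p hp => by simp [hsub hp]]
      exact hl w (hsub (Metric.mem_closedBall_self (by linarith [hh l]))) _
  have hconvlim : ∀ z ∈ segment ℝ x y,
      Tendsto (fun n => ∫ w, K.indicator v w * (ρ n).normed volume (z - w)) atTop (𝓝 (v z)) := by
    intro z hz
    have hKz : K ∈ 𝓝 z := mem_of_superset (Metric.closedBall_mem_nhds z hδ) (hball z hz)
    have hGz : Tendsto (K.indicator v) (𝓝 z) (𝓝 (v z)) :=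
      (hv.continuousAt (hΩo.mem_nhds (hSΩ hz))).congr' <| by
        filter_upwards [hKz] with w hw
        simp [hw]
    have := ContDiffBump.convolution_tendsto_right (μ := volume) (φ := ρ)
      (g := fun _ => K.indicator v) (k := fun _ => z) hρ0
      (Eventually.of_forall fun _ => hGm.aestronglyMeasurable) (hGz.comp tendsto_snd)
      tendsto_const_nhds
    refine this.congr fun n => ?_
    rw [convolution_lsmul_swap]
    simp only [smul_eq_mul, mul_comm]
  have hmem : a • x + b • y ∈ segment ℝ x y := ⟨a, b, ha, hb, hab, rfl⟩
  refine le_of_tendsto_of_tendsto' (hconvlim _ hmem)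
    (((hconvlim x (left_mem_segment ℝ x y)).const_smul a).add
      ((hconvlim y (right_mem_segment ℝ x y)).const_smul b)) fun n => ?_
  have := (hconvex n).2 (Set.left_mem_Icc.2 zero_le_one) (Set.right_mem_Icc.2 zero_le_one)
    ha hb hab
  have hxy : x + b • (y - x) = a • x + b • y := by
    rw [show a = 1 - b by linarith]
    module
  simpa [hxy] using this

theorem nat_mul_sub_le_of_second_diff_nonneg {b : ℕ → ℝ} {N : ℕ}
    (hb : ∀ k, k + 2 ≤ N → 2 * b (k + 1) ≤ b (k + 2) + b k) :
    N * (b 1 - b 0) ≤ b N - b 0 := by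
  have slope : ∀ k, k + 1 ≤ N → b 1 - b 0 ≤ b (k + 1) - b k := by
    intro k
    induction k with
    | zero => intro _; simp
    | succ k ih => intro hk; linarith [ih (by omega), hb k hk]
  have key : ∀ n, n ≤ N → n * (b 1 - b 0) ≤ b n - b 0 := by
    intro n
    induction n with
    | zero => intro _; simp
    | succ n ih =>
      intro hn
      have := ih (by omega)
      push_cast
      linarith [slope n hn]
  exact key N le_rfl

theorem add_int_smul_bv_mem_gridZ {h : ℝ} {z : Fin d → ℝ} (hz : z ∈ gridZ d h) (m : ℤ)
    (i : Fin d) : z + (m * h) • bv d i ∈ gridZ d h := by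
  intro j
  obtain ⟨k, hk⟩ := hz j
  by_cases hij : j = i
  · subst hij
    exact ⟨k + m, by simp [bv, hk]; ring⟩
  · exact ⟨k, by simp [bv, hk, hij]⟩

section LipschitzEstimate

variable {u : (Fin d → ℝ) → ℝ} {h r M : ℝ} {x₀ : Fin d → ℝ}

theorem abs_step_le (hh : 0 < h) (hhr : h ≤ r)
    (hM : ∀ z ∈ gridZ d h, z ∈ Metric.closedBall x₀ (2 * r) → |u z| ≤ M)
    (hcv : ∀ z ∈ gridZ d h, z ∈ Metric.closedBall x₀ (2 * r) → ∀ i,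
      2 * u z ≤ u (z + h • bv d i) + u (z - h • bv d i))
    {z : Fin d → ℝ} (hz : z ∈ gridZ d h) (hzb : z ∈ Metric.closedBall x₀ r) (i : Fin d) :
    |u (z + h • bv d i) - u z| ≤ 4 * M / r * h := by
  have hr : 0 < r := hh.trans_le hhr
  set N := ⌊r / h⌋₊ with hN
  have hN1 : 1 ≤ N := Nat.le_floor (by rw [Nat.cast_one, le_div_iff₀ hh]; linarith)
  have hN1' : (1 : ℝ) ≤ N := by exact_mod_cast hN1
  have hNh : N * h ≤ r := by
    rw [← le_div_iff₀ hh]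
    exact Nat.floor_le (by positivity)
  have hNr : r ≤ 2 * (N * h) := by
    have := Nat.lt_floor_add_one (r / h)
    rw [← hN, div_lt_iff₀ hh] at this
    nlinarith
  have hmem : ∀ m : ℤ, |m| ≤ N → z + (m * h) • bv d i ∈ Metric.closedBall x₀ (2 * r) := by
    intro m hm
    have hm' : |(m : ℝ)| ≤ N := by exact_mod_cast hm
    rw [mem_closedBall_iff_norm] at hzb ⊢
    rw [add_sub_right_comm]
    refine (norm_add_le _ _).trans ?_
    rw [norm_real_smul_bv, abs_mul, abs_of_pos hh]
    nlinarith
  have hMm : ∀ m : ℤ, |m| ≤ N → |u (z + (m * h) • bv d i)| ≤ M := fun m hm =>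
    hM _ (add_int_smul_bv_mem_gridZ hz m i) (hmem m hm)
  have hcm : ∀ m : ℤ, |m| ≤ N → 2 * u (z + (m * h) • bv d i) ≤
      u (z + ((m + 1 : ℤ) * h) • bv d i) + u (z + ((m - 1 : ℤ) * h) • bv d i) := by
    intro m hm
    have := hcv _ (add_int_smul_bv_mem_gridZ hz m i) (hmem m hm) i
    convert this using 3
    · push_cast; module
    · push_cast; module
  have up := nat_mul_sub_le_of_second_diff_nonneg (N := N)
    (b := fun k => u (z + (((k : ℕ) : ℤ) * h) • bv d i)) fun k hk => by
      have := hcm (k + 1) (abs_le.2 ⟨by omega, by omega⟩)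
      rw [add_sub_cancel_right, add_assoc] at this
      exact_mod_cast this
  have dn := nat_mul_sub_le_of_second_diff_nonneg (N := N)
    (b := fun k => u (z + ((1 - ((k : ℕ) : ℤ) : ℤ) * h) • bv d i)) fun k hk => by
      have := hcm (-k) (abs_le.2 ⟨by omega, by omega⟩)
      have e1 : (1 - ((k + 1 : ℕ) : ℤ)) = -k := by push_cast; ring
      have e2 : (1 - ((k + 2 : ℕ) : ℤ)) = -k - 1 := by push_cast; ring
      have e3 : (1 - ((k : ℕ) : ℤ)) = -k + 1 := by ring
      simp only [e1, e2, e3]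
      linarith
  have hb0 := abs_le.1 (hMm 0 (by simp))
  have hb1 := abs_le.1 (hMm 1 (by simpa using by exact_mod_cast hN1))
  have hbN := abs_le.1 (hMm N (by simp))
  have hbN' := abs_le.1 (hMm (1 - N) (abs_le.2 ⟨by omega, by omega⟩))
  simp only [Nat.cast_one, Nat.cast_zero, sub_self, sub_zero] at up dn
  have e0 : z + (((0 : ℤ) : ℝ) * h) • bv d i = z := by simp
  have e1 : z + (((1 : ℤ) : ℝ) * h) • bv d i = z + h • bv d i := by simp
  rw [e0] at up dn hb0
  rw [e1] at up dn hb1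
  have hM0 : 0 ≤ M := by linarith [hb0.1, hb0.2]
  rw [div_mul_eq_mul_div, le_div_iff₀ hr]
  set D := u (z + h • bv d i) - u z with hD
  have hA : |D| * N ≤ 2 * M := by
    rcases abs_cases D with ⟨hc, -⟩ | ⟨hc, -⟩ <;> rw [hc] <;> nlinarith [hb0.1, hb0.2, hb1.1,
      hb1.2, hbN.1, hbN.2, hbN'.1, hbN'.2]
  calc |D| * r ≤ |D| * (2 * (N * h)) := by gcongr
    _ = 2 * h * (|D| * N) := by ring
    _ ≤ 2 * h * (2 * M) := by gcongr
    _ = 4 * M * h := by ring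

theorem abs_line_le (hh : 0 < h) (hhr : h ≤ r)
    (hM : ∀ z ∈ gridZ d h, z ∈ Metric.closedBall x₀ (2 * r) → |u z| ≤ M)
    (hcv : ∀ z ∈ gridZ d h, z ∈ Metric.closedBall x₀ (2 * r) → ∀ i,
      2 * u z ≤ u (z + h • bv d i) + u (z - h • bv d i))
    {z : Fin d → ℝ} (hz : z ∈ gridZ d h) (hzb : z ∈ Metric.closedBall x₀ r) (i : Fin d) (n : ℕ)
    (hn : z + (n * h) • bv d i ∈ Metric.closedBall x₀ r) :
    |u (z + (n * h) • bv d i) - u z| ≤ 4 * M / r * (n * h) := by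
  induction n with
  | zero => simp
  | succ n ih =>
    have hmem : z + (n * h) • bv d i ∈ Metric.closedBall x₀ r := by
      have := (convex_closedBall x₀ r).add_smul_mem hzb hn (t := (n : ℝ) / (n + 1))
        ⟨by positivity, div_le_one_of_le₀ (by linarith) (by positivity)⟩
      convert this using 2
      rw [smul_smul]
      congr 1
      push_cast
      field_simp
    have hg : z + (n * h) • bv d i ∈ gridZ d h := by
      simpa using add_int_smul_bv_mem_gridZ hz n i
    have h1 := ih hmem
    have h2 := abs_step_le hh hhr hM hcv hg hmem i
    have e : z + (n * h) • bv d i + h • bv d i = z + ((n + 1 : ℕ) * h) • bv d i := by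
      push_cast; module
    rw [e] at h2
    refine (abs_sub_le _ (u (z + (n * h) • bv d i)) _).trans ?_
    push_cast at *
    linarith

theorem abs_sub_le_of_second_diff_nonneg (hh : 0 < h) (hhr : h ≤ r)
    (hM : ∀ z ∈ gridZ d h, z ∈ Metric.closedBall x₀ (2 * r) → |u z| ≤ M)
    (hcv : ∀ z ∈ gridZ d h, z ∈ Metric.closedBall x₀ (2 * r) → ∀ i,
      2 * u z ≤ u (z + h • bv d i) + u (z - h • bv d i))
    {x y : Fin d → ℝ} (hx : x ∈ gridZ d h) (hxb : x ∈ Metric.closedBall x₀ r)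
    (hy : y ∈ gridZ d h) (hyb : y ∈ Metric.closedBall x₀ r) :
    |u y - u x| ≤ 4 * M / r * ∑ i, |y i - x i| := by
  have hr : 0 < r := hh.trans_le hhr
  have hg : ∀ s : Finset (Fin d), s.piecewise y x ∈ gridZ d h := fun s i => by
    by_cases hi : i ∈ s
    · simpa [hi] using hy i
    · simpa [hi] using hx i
  have hb : ∀ s : Finset (Fin d), s.piecewise y x ∈ Metric.closedBall x₀ r := fun s => by
    rw [Metric.mem_closedBall, dist_pi_le_iff hr.le] at *
    intro i
    by_cases hi : i ∈ s
    · simpa [hi] using hyb i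
    · simpa [hi] using hxb i
  have key : ∀ s : Finset (Fin d),
      |u (s.piecewise y x) - u x| ≤ 4 * M / r * ∑ i ∈ s, |y i - x i| := by
    intro s
    induction s using Finset.induction_on with
    | empty => simp
    | insert i s hi ih =>
      rw [Finset.sum_insert hi, mul_add]
      refine (abs_sub_le _ (u (s.piecewise y x)) _).trans (add_le_add ?_ ih)
      obtain ⟨k, hk⟩ := hy i
      obtain ⟨m, hm⟩ := hx i
      have hz : (insert i s).piecewise y x = s.piecewise y x + ((k - m : ℤ) * h) • bv d i := by
        rw [Finset.piecewise_insert]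
        funext j
        by_cases hij : j = i
        · subst hij
          simp [hi, bv, hk, hm]
          ring
        · simp [hij, bv]
      have hd : |y i - x i| = |((k - m : ℤ) : ℝ)| * h := by
        rw [hk, hm, ← sub_mul, abs_mul, abs_of_pos hh]
        push_cast
        rfl
      rw [hd]
      have hb1 := hb s
      have hb2 := hb (insert i s)
      have hg1 := hg s
      have hg2 := hg (insert i s)
      rcases Int.eq_nat_or_neg (k - m) with ⟨n, hn | hn⟩
      · rw [hz, hn] at hb2 ⊢
        simpa using abs_line_le hh hhr hM hcv hg1 hb1 i n (by simpa using hb2)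
      · have hz' : s.piecewise y x = (insert i s).piecewise y x + (n * h) • bv d i := by
          rw [hz, hn]
          push_cast
          module
        rw [abs_sub_comm, hn]
        rw [hz'] at hb1 ⊢
        simpa using abs_line_le hh hhr hM hcv hg2 hb2 i n hb1
  simpa using key Finset.univ

end LipschitzEstimate

section AsymptoticEquicontinuity

variable {X : Type*} [PseudoMetricSpace X] {Ω : Set X} {f : ℕ → X → ℝ}

theorem exists_subseq_tendsto_of_countable {D : Type*} [Countable D] {f : ℕ → D → ℝ}
    (hB : ∀ x, ∃ M : ℝ, ∀ᶠ l in atTop, |f l x| ≤ M) :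
    ∃ φ : ℕ → ℕ, StrictMono φ ∧ ∀ x, ∃ c : ℝ, Tendsto (fun q => f (φ q) x) atTop (𝓝 c) := by
  classical
  choose M hM using hB
  let g : ℕ → D → ℝ := fun l x => if |f l x| ≤ M x then f l x else 0
  have hg : ∀ l, g l ∈ Set.univ.pi fun x => Set.Icc (-|M x|) |M x| := fun l x _ => by
    refine Set.mem_Icc.2 (abs_le.1 ?_)
    simp only [g]
    split_ifs with hx
    · exact hx.trans (le_abs_self _)
    · simp
  obtain ⟨a, -, φ, hφ, ha⟩ :=
    (isCompact_univ_pi fun x => isCompact_Icc (a := -|M x|) (b := |M x|)).tendsto_subseq hg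
  refine ⟨φ, hφ, fun x => ⟨a x, (tendsto_pi_nhds.1 ha x).congr' ?_⟩⟩
  filter_upwards [hφ.tendsto_atTop.eventually (hM x)] with q hq
  simp [g, hq]

theorem exists_subseq_tendsto_of_asymptotic_equicontinuous
    [TopologicalSpace.SeparableSpace X] (hΩ : IsOpen Ω)
    (hE : ∀ x₀ ∈ Ω, ∀ ε > 0, ∃ δ > 0, ∀ᶠ l in atTop, ∀ x ∈ Metric.ball x₀ δ,
      |f l x - f l x₀| ≤ ε)
    (hB : ∀ x₀ ∈ Ω, ∃ M : ℝ, ∀ᶠ l in atTop, |f l x₀| ≤ M) :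
    ∃ φ : ℕ → ℕ, StrictMono φ ∧ ∃ v : X → ℝ, ∀ x ∈ Ω,
      Tendsto (fun q => f (φ q) x) atTop (𝓝 (v x)) := by
  obtain ⟨D, hDc, hDd⟩ := TopologicalSpace.exists_countable_dense X
  have : Countable (D ∩ Ω : Set X) := (hDc.mono Set.inter_subset_left).to_subtype
  obtain ⟨φ, hφ, hconv⟩ := exists_subseq_tendsto_of_countable
    (f := fun l (x : (D ∩ Ω : Set X)) => f l x) fun x => hB x x.2.2
  have hlim : ∀ x ∈ Ω, ∃ c : ℝ, Tendsto (fun q => f (φ q) x) atTop (𝓝 c) := by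
    intro x hx
    refine cauchySeq_tendsto_of_complete (Metric.cauchySeq_iff'.2 fun ε hε => ?_)
    obtain ⟨δ, hδ, hEl⟩ := hE x hx (ε / 4) (by positivity)
    obtain ⟨y, ⟨hyb, hyΩ⟩, hyD⟩ := hDd.inter_open_nonempty (Metric.ball x δ ∩ Ω)
      (Metric.isOpen_ball.inter hΩ) ⟨x, Metric.mem_ball_self hδ, hx⟩
    obtain ⟨c, hc⟩ := hconv ⟨y, hyD, hyΩ⟩
    obtain ⟨N₁, hN₁⟩ := Metric.cauchySeq_iff.1 hc.cauchySeq (ε / 4) (by positivity)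
    obtain ⟨N₂, hN₂⟩ := eventually_atTop.1 (hφ.tendsto_atTop.eventually hEl)
    refine ⟨max N₁ N₂, fun n hn => ?_⟩
    have h1 := hN₁ n (le_of_max_le_left hn) _ (le_max_left N₁ N₂)
    have h2 := abs_le.1 (hN₂ n (le_of_max_le_right hn) y hyb)
    have h3 := abs_le.1 (hN₂ _ (le_max_right N₁ N₂) y hyb)
    rw [Real.dist_eq, abs_lt] at h1 ⊢
    dsimp only at h1
    constructor <;> linarith [h1.1, h1.2, h2.1, h2.2, h3.1, h3.2]
  choose! v hv using hlim
  exact ⟨φ, hφ, v, hv⟩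

variable {v : X → ℝ}

theorem abs_sub_le_of_asymptotic_equicontinuous (hv : ∀ x ∈ Ω,
    Tendsto (fun q => f q x) atTop (𝓝 (v x))) {x₀ : X} (hx₀ : x₀ ∈ Ω) {δ ε : ℝ}
    (hE : ∀ᶠ l in atTop, ∀ x ∈ Metric.ball x₀ δ, |f l x - f l x₀| ≤ ε) {x : X}
    (hx : x ∈ Metric.ball x₀ δ ∩ Ω) : |v x - v x₀| ≤ ε :=
  le_of_tendsto ((hv x hx.2).sub (hv x₀ hx₀)).abs (hE.mono fun _ hl => hl x hx.1)

theorem continuousOn_of_asymptotic_equicontinuous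
    (hE : ∀ x₀ ∈ Ω, ∀ ε > 0, ∃ δ > 0, ∀ᶠ l in atTop, ∀ x ∈ Metric.ball x₀ δ,
      |f l x - f l x₀| ≤ ε)
    (hv : ∀ x ∈ Ω, Tendsto (fun q => f q x) atTop (𝓝 (v x))) : ContinuousOn v Ω := by
  refine Metric.continuousOn_iff.2 fun x₀ hx₀ ε hε => ?_
  obtain ⟨δ, hδ, hEl⟩ := hE x₀ hx₀ (ε / 2) (by positivity)
  refine ⟨δ, hδ, fun x hx hxδ => ?_⟩
  rw [Real.dist_eq]
  exact (abs_sub_le_of_asymptotic_equicontinuous hv hx₀ hEl ⟨hxδ, hx⟩).trans_lt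
    (half_lt_self hε)

theorem tendstoLocallyUniformlyOn_of_asymptotic_equicontinuous
    (hE : ∀ x₀ ∈ Ω, ∀ ε > 0, ∃ δ > 0, ∀ᶠ l in atTop, ∀ x ∈ Metric.ball x₀ δ,
      |f l x - f l x₀| ≤ ε)
    (hv : ∀ x ∈ Ω, Tendsto (fun q => f q x) atTop (𝓝 (v x))) :
    TendstoLocallyUniformlyOn f v atTop Ω := by
  refine Metric.tendstoLocallyUniformlyOn_iff.2 fun ε hε x₀ hx₀ => ?_
  obtain ⟨δ, hδ, hEl⟩ := hE x₀ hx₀ (ε / 4) (by positivity)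
  refine ⟨Metric.ball x₀ δ ∩ Ω,
    Filter.inter_mem (mem_nhdsWithin_of_mem_nhds (Metric.ball_mem_nhds x₀ hδ))
      self_mem_nhdsWithin, ?_⟩
  filter_upwards [hEl, Metric.tendsto_nhds.1 (hv x₀ hx₀) (ε / 4) (by positivity)]
    with l hl h0 x hx
  have h1 := abs_le.1 (hl x hx.1)
  have h2 := abs_le.1 (abs_sub_le_of_asymptotic_equicontinuous hv hx₀ hEl hx)
  rw [Real.dist_eq, abs_lt] at *
  constructor <;> linarith [h1.1, h1.2, h2.1, h2.2, h0.1, h0.2]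

end AsymptoticEquicontinuity

/-- Rounding every coordinate down to the grid of mesh size `h`. -/
def gridFloor (h : ℝ) (y : Fin d → ℝ) : Fin d → ℝ := fun i => ⌊y i / h⌋ * h

theorem gridFloor_mem_gridZ (h : ℝ) (y : Fin d → ℝ) : gridFloor h y ∈ gridZ d h :=
  fun i => ⟨⌊y i / h⌋, rfl⟩

theorem gridFloor_of_mem_gridZ {h : ℝ} (hh : 0 < h) {y : Fin d → ℝ} (hy : y ∈ gridZ d h) :
    gridFloor h y = y := by
  funext i
  obtain ⟨k, hk⟩ := hy i
  simp [gridFloor, hk, hh.ne']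

theorem abs_gridFloor_sub_le {h : ℝ} (hh : 0 < h) (y : Fin d → ℝ) (i : Fin d) :
    |gridFloor h y i - y i| ≤ h := by
  have h1 := Int.floor_le (y i / h)
  have h2 := Int.lt_floor_add_one (y i / h)
  rw [le_div_iff₀ hh] at h1
  rw [div_lt_iff₀ hh] at h2
  rw [gridFloor, abs_le]
  constructor <;> linarith

theorem dist_gridFloor_le {h : ℝ} (hh : 0 < h) (y : Fin d → ℝ) : dist (gridFloor h y) y ≤ h :=
  (dist_pi_le_iff hh.le).2 fun i => abs_gridFloor_sub_le hh y i

theorem gridFloor_add_smul_bv {h : ℝ} (hh : 0 < h) (y : Fin d → ℝ) (i : Fin d) :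
    gridFloor h (y + h • bv d i) = gridFloor h y + h • bv d i := by
  funext j
  by_cases hij : j = i
  · subst hij
    simp [gridFloor, bv, add_div, hh.ne', add_mul]
  · simp [gridFloor, bv, hij]

theorem gridFloor_sub_smul_bv {h : ℝ} (hh : 0 < h) (y : Fin d → ℝ) (i : Fin d) :
    gridFloor h (y - h • bv d i) = gridFloor h y - h • bv d i := by
  have := gridFloor_add_smul_bv hh (y - h • bv d i) i
  rw [sub_add_cancel] at this
  rw [this, add_sub_cancel_right]

theorem Hc_comp_gridFloor {h : ℝ} (hh : 0 < h) (u : (Fin d → ℝ) → ℝ) (y : Fin d → ℝ) :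
    Hc h (fun y => u (gridFloor h y)) y = Hc h u (gridFloor h y) := by
  ext i j
  simp only [Hc, gridFloor_add_smul_bv hh, gridFloor_sub_smul_bv hh]

theorem measurable_comp_gridFloor (h : ℝ) (u : (Fin d → ℝ) → ℝ) :
    Measurable fun y => u (gridFloor h y) := by
  have h1 : Measurable fun y : Fin d → ℝ => fun i => ⌊y i / h⌋ := by fun_prop
  have h2 : Measurable fun k : Fin d → ℤ => u fun i => (k i : ℝ) * h := measurable_of_countable _
  exact h2.comp h1

theorem mem_OmegaH0_of_closedBall_subset {Ω : Set (Fin d → ℝ)} {h : ℝ} (hh : 0 < h)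
    {z : Fin d → ℝ} (hz : z ∈ gridZ d h) (hb : Metric.closedBall z (2 * h) ⊆ Ω) :
    z ∈ OmegaH0 Ω h := by
  refine ⟨⟨subset_closure (hb (Metric.mem_closedBall_self (by linarith))), hz⟩,
    fun i j s t => subset_closure (hb ?_)⟩
  have hn : ∀ (s : Bool) (i : Fin d), ‖(if s then h else -h) • bv d i‖ = h := fun s i => by
    rw [norm_real_smul_bv]
    split_ifs <;> simp [abs_of_pos hh]
  rw [mem_closedBall_iff_norm, add_assoc, add_sub_cancel_left]
  refine (norm_add_le _ _).trans ?_
  rw [hn, hn, two_mul]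

theorem sum_Hc_nonneg {h : ℝ} {u : (Fin d → ℝ) → ℝ} {z : Fin d → ℝ}
    (hp : (Hc h u z).PosSemidef) (ξ : Fin d → ℝ) :
    0 ≤ ∑ i, ∑ j, ξ i * ξ j * Hc h u z i j := by
  have := hp.dotProduct_mulVec_nonneg ξ
  simp only [dotProduct, Matrix.mulVec, Finset.mul_sum] at this
  refine this.trans_eq (Finset.sum_congr rfl fun i _ => Finset.sum_congr rfl fun j _ => ?_)
  rw [Pi.star_apply, star_trivial]
  ring

theorem two_mul_le_of_posSemidef {h : ℝ} (hh : 0 < h) {u : (Fin d → ℝ) → ℝ} {z : Fin d → ℝ}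
    (hp : (Hc h u z).PosSemidef) (i : Fin d) :
    2 * u z ≤ u (z + h • bv d i) + u (z - h • bv d i) := by
  have := hp.diag_nonneg (i := i)
  rw [Hc_apply_eq, if_pos rfl] at this
  rw [le_div_iff₀ (by positivity)] at this
  linarith

section Sequence

variable {Ω : Set (Fin d → ℝ)} {h : ℕ → ℝ} {u : ℕ → (Fin d → ℝ) → ℝ}

theorem eventually_bounded_comp_gridFloor (hΩo : IsOpen Ω) (hh : ∀ l, 0 < h l)
    (hlim : Tendsto h atTop (𝓝 0))
    (hbd : ∀ K : Set (Fin d → ℝ), IsCompact K → K ⊆ Ω →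
      ∃ M : ℝ, 0 < M ∧ ∀ l, ∀ x ∈ K ∩ OmegaH Ω (h l), |u l x| ≤ M)
    {K : Set (Fin d → ℝ)} (hK : IsCompact K) (hKΩ : K ⊆ Ω) :
    ∃ M : ℝ, ∀ᶠ l in atTop, ∀ y ∈ K, |u l (gridFloor (h l) y)| ≤ M := by
  obtain ⟨δ, hδ, hδΩ⟩ := hK.exists_cthickening_subset_open hΩo hKΩ
  obtain ⟨M, -, hM⟩ := hbd _ hK.cthickening hδΩ
  refine ⟨M, ?_⟩
  filter_upwards [hlim.eventually (eventually_le_nhds hδ)] with l hl y hy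
  have hmem : gridFloor (h l) y ∈ Metric.cthickening δ K :=
    Metric.closedBall_subset_cthickening hy δ ((dist_gridFloor_le (hh l) y).trans hl)
  exact hM l _ ⟨hmem, subset_closure (hδΩ hmem), gridFloor_mem_gridZ _ _⟩

theorem eventually_sum_Hc_comp_gridFloor_nonneg (hΩo : IsOpen Ω) (hh : ∀ l, 0 < h l)
    (hlim : Tendsto h atTop (𝓝 0))
    (hconv : ∀ l, ∀ x ∈ OmegaH0 Ω (h l), (Hc (h l) (u l) x).PosSemidef)
    {K : Set (Fin d → ℝ)} (hK : IsCompact K) (hKΩ : K ⊆ Ω) :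
    ∀ᶠ l in atTop, ∀ y ∈ K, ∀ ξ : Fin d → ℝ,
      0 ≤ ∑ i, ∑ j, ξ i * ξ j * Hc (h l) (fun y => u l (gridFloor (h l) y)) y i j := by
  obtain ⟨δ, hδ, hδΩ⟩ := hK.exists_cthickening_subset_open hΩo hKΩ
  filter_upwards [hlim.eventually (eventually_le_nhds (show (0 : ℝ) < δ / 3 by positivity))]
    with l hl y hy ξ
  rw [Hc_comp_gridFloor (hh l)]
  refine sum_Hc_nonneg (hconv l _ (mem_OmegaH0_of_closedBall_subset (hh l)
    (gridFloor_mem_gridZ _ _) fun z hz => ?_)) ξ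
  refine hδΩ (Metric.closedBall_subset_cthickening hy δ ?_)
  rw [Metric.mem_closedBall] at *
  linarith [dist_triangle z (gridFloor (h l) y) y, dist_gridFloor_le (hh l) y]

theorem asymptotic_equicontinuous_comp_gridFloor (hΩo : IsOpen Ω) (hh : ∀ l, 0 < h l)
    (hlim : Tendsto h atTop (𝓝 0))
    (hconv : ∀ l, ∀ x ∈ OmegaH0 Ω (h l), (Hc (h l) (u l) x).PosSemidef)
    (hbd : ∀ K : Set (Fin d → ℝ), IsCompact K → K ⊆ Ω →
      ∃ M : ℝ, 0 < M ∧ ∀ l, ∀ x ∈ K ∩ OmegaH Ω (h l), |u l x| ≤ M)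
    {x₀ : Fin d → ℝ} (hx₀ : x₀ ∈ Ω) {ε : ℝ} (hε : 0 < ε) :
    ∃ δ > 0, ∀ᶠ l in atTop, ∀ x ∈ Metric.ball x₀ δ,
      |u l (gridFloor (h l) x) - u l (gridFloor (h l) x₀)| ≤ ε := by
  obtain ⟨R, hR, hRΩ⟩ := Metric.nhds_basis_closedBall.mem_iff.1 (hΩo.mem_nhds hx₀)
  obtain ⟨M, hM0, hM⟩ := hbd _ (isCompact_closedBall x₀ R) hRΩ
  set r := R / 4 with hr
  have hr0 : 0 < r := by positivity
  set L := 4 * M / r with hL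
  have hL0 : 0 < L := by positivity
  set η := ε / (3 * L * (d + 1)) with hη
  have hη0 : 0 < η := by positivity
  refine ⟨min (r / 2) η, lt_min (by positivity) hη0, ?_⟩
  filter_upwards [hlim.eventually (eventually_le_nhds (half_pos hr0)),
    hlim.eventually (eventually_le_nhds hη0)] with l hlr hlη x hx
  have hhl := hh l
  rw [Metric.mem_ball, lt_min_iff] at hx
  have hmem : ∀ x, dist x x₀ ≤ r / 2 → gridFloor (h l) x ∈ Metric.closedBall x₀ r := by
    intro x hx
    rw [Metric.mem_closedBall]
    linarith [dist_triangle (gridFloor (h l) x) x x₀, dist_gridFloor_le hhl x]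
  have hLip := abs_sub_le_of_second_diff_nonneg (u := u l) (M := M) (x₀ := x₀) hhl
    (show h l ≤ r by linarith) (fun z hz hzb => ?_) (fun z hz hzb i => ?_)
    (gridFloor_mem_gridZ (h l) x₀) (hmem x₀ (by simpa using (half_pos hr0).le))
    (gridFloor_mem_gridZ (h l) x) (hmem x hx.1.le)
  · refine hLip.trans ?_
    have hsum : ∑ i, |gridFloor (h l) x i - gridFloor (h l) x₀ i| ≤ ∑ _i : Fin d, 3 * η := by
      refine Finset.sum_le_sum fun i _ => ?_
      have h1 := abs_le.1 (abs_gridFloor_sub_le hhl x i)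
      have h2 := abs_le.1 (abs_gridFloor_sub_le hhl x₀ i)
      have h3 := (dist_le_pi_dist x x₀ i).trans hx.2.le
      rw [Real.dist_eq] at h3
      have h3 := abs_le.1 h3
      rw [abs_le]
      constructor <;> linarith [h1.1, h1.2, h2.1, h2.2, h3.1, h3.2]
    calc L * ∑ i, |gridFloor (h l) x i - gridFloor (h l) x₀ i|
        ≤ L * ∑ _i : Fin d, 3 * η := by gcongr
      _ = 3 * L * d * η := by simp; ring
      _ ≤ 3 * L * (d + 1) * η := by gcongr; linarith
      _ = ε := by rw [hη]; field_simp
  · have hzR : z ∈ Metric.closedBall x₀ R := Metric.closedBall_subset_closedBall (by linarith) hzb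
    exact hM l z ⟨hzR, subset_closure (hRΩ hzR), hz⟩
  · refine two_mul_le_of_posSemidef hhl (hconv l z
      (mem_OmegaH0_of_closedBall_subset hhl hz fun w hw => hRΩ ?_)) i
    rw [Metric.mem_closedBall] at *
    linarith [dist_triangle w z x₀]

end Sequence

end MA

/-- a locally uniformly bounded sequence of discrete convex grid functions
(on grids with mesh sizes tending to zero) has a subsequence converging, uniformly on the
grid points of each compact subset of `Ω`, to a convex function on `Ω`. -/
theorem stmt18 {d : ℕ} (hd : 2 ≤ d) (Ω : Set (Fin d → ℝ))
    (hΩo : IsOpen Ω) (hΩc : Convex ℝ Ω) (hΩb : Bornology.IsBounded Ω)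
    (h : ℕ → ℝ) (hh : ∀ l, 0 < h l ∧ h l < 1)
    (hlim : Filter.Tendsto h Filter.atTop (nhds 0))
    (u : ℕ → (Fin d → ℝ) → ℝ)
    (hconv : ∀ l, ∀ x ∈ MA.OmegaH0 Ω (h l), (MA.Hc (h l) (u l) x).PosSemidef)
    (hbd : ∀ K : Set (Fin d → ℝ), IsCompact K → K ⊆ Ω →
      ∃ M : ℝ, 0 < M ∧ ∀ l, ∀ x ∈ K ∩ MA.OmegaH Ω (h l), |u l x| ≤ M) :
    ∃ φ : ℕ → ℕ, StrictMono φ ∧ ∃ v : (Fin d → ℝ) → ℝ, ConvexOn ℝ Ω v ∧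
      ∀ K : Set (Fin d → ℝ), IsCompact K → K ⊆ Ω →
        ∀ ε : ℝ, 0 < ε → ∃ Q : ℕ, ∀ q : ℕ, Q ≤ q →
          ∀ x ∈ K ∩ MA.OmegaH Ω (h (φ q)), |u (φ q) x - v x| ≤ ε := by
  have hh0 : ∀ l, 0 < h l := fun l => (hh l).1
  have hequi := fun x₀ (hx₀ : x₀ ∈ Ω) ε (hε : (0 : ℝ) < ε) =>
    MA.asymptotic_equicontinuous_comp_gridFloor hΩo hh0 hlim hconv hbd hx₀ hε
  obtain ⟨φ, hφ, v, hv⟩ := MA.exists_subseq_tendsto_of_asymptotic_equicontinuous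
    (f := fun l y => u l (MA.gridFloor (h l) y)) hΩo hequi fun x₀ hx₀ => by
      obtain ⟨M, hM⟩ := MA.eventually_bounded_comp_gridFloor hΩo hh0 hlim hbd
        isCompact_singleton (Set.singleton_subset_iff.2 hx₀)
      exact ⟨M, hM.mono fun l hl => hl x₀ rfl⟩
  have hφt := hφ.tendsto_atTop
  have hequiφ : ∀ x₀ ∈ Ω, ∀ ε > 0, ∃ δ > 0, ∀ᶠ q in Filter.atTop, ∀ x ∈ Metric.ball x₀ δ,
      |u (φ q) (MA.gridFloor (h (φ q)) x) - u (φ q) (MA.gridFloor (h (φ q)) x₀)| ≤ ε := by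
    intro x₀ hx₀ ε hε
    obtain ⟨δ, hδ, hl⟩ := hequi x₀ hx₀ ε hε
    exact ⟨δ, hδ, hφt.eventually hl⟩
  refine ⟨φ, hφ, v, ?_, fun K hK hKΩ ε hε => ?_⟩
  · refine MA.convexOn_of_tendsto_of_Hc_nonneg hΩo hΩc (h := fun q => h (φ q))
      (fun q => hh0 _) (hlim.comp hφt) (fun q => MA.measurable_comp_gridFloor _ _) hv
      (MA.continuousOn_of_asymptotic_equicontinuous hequiφ hv) (fun K hK hKΩ => ?_)
      fun K hK hKΩ => hφt.eventually
        (MA.eventually_sum_Hc_comp_gridFloor_nonneg hΩo hh0 hlim hconv hK hKΩ)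
    obtain ⟨M, hM⟩ := MA.eventually_bounded_comp_gridFloor hΩo hh0 hlim hbd hK hKΩ
    exact ⟨M, hφt.eventually hM⟩
  · have hunif := (tendstoLocallyUniformlyOn_iff_forall_isCompact hΩo).1
      (MA.tendstoLocallyUniformlyOn_of_asymptotic_equicontinuous hequiφ hv) K hKΩ hK
    obtain ⟨Q, hQ⟩ := Filter.eventually_atTop.1 (Metric.tendstoUniformlyOn_iff.1 hunif ε hε)
    refine ⟨Q, fun q hq x hx => ?_⟩
    have := hQ q hq x hx.1
    rw [MA.gridFloor_of_mem_gridZ (hh0 _) hx.2.2, dist_comm, Real.dist_eq] at this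
    exact this.le
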